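/- Let M = (Q, p₀, F, Δ) be a normal s-AFA over an alphabet type α, i.e., for every state x ∈ Q and every character a : α there is exactly one pair (φ, p) with (x, φ, p) ∈ Δ and a ∈ φ. Let the De Morgan dual p̄ of a positive Boolean formula be obtained by swapping and with or and tt with ff while fixing variables, and define the complement automaton M̄ = (Q, p̄₀, Q \ F, { (x, φ, p̄) : (x, φ, p) ∈ Δ }). Then the language of M̄ is the complement of the language of M: L(M̄) = { w : List α } \ L(M). -/

import Mathlib

/-- Positive Boolean formulas over a type `Q`. -/
inductive PBF (Q : Type u) : Type u where
  | tt : PBF Q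
  | ff : PBF Q
  | var : Q → PBF Q
  | and : PBF Q → PBF Q → PBF Q
  | or : PBF Q → PBF Q → PBF Q

/-- Evaluation of a positive Boolean formula under a model `m : Q → Bool`. -/
def PBF.eval {Q : Type*} (m : Q → Bool) : PBF Q → Bool
  | .tt => true
  | .ff => false
  | .var q => m q
  | .and p q => p.eval m && q.eval m
  | .or p q => p.eval m || q.eval m

/-- Substitution: replace each variable `q` by `σ q`. -/
def PBF.subst {Q R : Type*} (σ : Q → PBF R) : PBF Q → PBF R
  | .tt => .tt
  | .ff => .ff
  | .var q => σ q
  | .and p q => .and (p.subst σ) (q.subst σ)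
  | .or p q => .or (p.subst σ) (q.subst σ)

/-- A symbolic alternating finite automaton over an alphabet type `α`. -/
structure SAFA (α : Type*) where
  /-- states -/
  Q : Type
  [fin : Fintype Q]
  /-- initial formula -/
  init : PBF Q
  /-- accepting states -/
  F : Set Q
  /-- transitions `(source, guard, target formula)` -/
  Δ : Finset (Q × Set α × PBF Q)

attribute [instance] SAFA.fin

/-- One-step transition function `Δ_a : Q → PBF Q`: the disjunction of all targets `q`
over transitions `(s, φ, q) ∈ Δ` with `a ∈ φ` (the empty disjunction is `ff`). -/
noncomputable def SAFA.step {α : Type*} (M : SAFA α) (a : α) (s : M.Q) : PBF M.Q :=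
  letI := Classical.propDecidable
  (M.Δ.toList.filter (fun t => decide (t.1 = s ∧ a ∈ t.2.1))).foldr
    (fun t acc => .or t.2.2 acc) .ff

/-- Transition function on words, extended to formulas by substitution:
`Δ_w = Δ_{aₙ} ∘ ⋯ ∘ Δ_{a₁}`. -/
noncomputable def SAFA.run {α : Type*} (M : SAFA α) (w : List α) (p : PBF M.Q) : PBF M.Q :=
  w.foldl (fun p a => p.subst (M.step a)) p

/-- `F̂ : PBF Q → Bool`: evaluation under the indicator function of the accepting set. -/
noncomputable def SAFA.Fhat {α : Type*} (M : SAFA α) (p : PBF M.Q) : Bool :=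
  letI := Classical.propDecidable
  p.eval (fun s => decide (s ∈ M.F))

/-- The language of a formula `p` in the s-AFA `M`. -/
noncomputable def SAFA.langOf {α : Type*} (M : SAFA α) (p : PBF M.Q) : Set (List α) :=
  { w : List α | M.Fhat (M.run w p) = true }

/-- The language of the s-AFA `M`. -/
noncomputable def SAFA.lang {α : Type*} (M : SAFA α) : Set (List α) :=
  M.langOf M.init

/-- De Morgan dual of a positive Boolean formula: swap `and` with `or` and `tt` with
`ff`, fixing variables. -/
def PBF.dual {Q : Type*} : PBF Q → PBF Q
  | .tt => .ff
  | .ff => .tt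
  | .var q => .var q
  | .and p q => .or p.dual q.dual
  | .or p q => .and p.dual q.dual

/-- An s-AFA is normal if for every state `x` and character `a` there is exactly one
pair `(φ, p)` with `(x, φ, p) ∈ Δ` and `a ∈ φ`. -/
def SAFA.Normal {α : Type*} (M : SAFA α) : Prop :=
  ∀ (x : M.Q) (a : α), ∃! t : Set α × PBF M.Q, (x, t.1, t.2) ∈ M.Δ ∧ a ∈ t.1

/-- The complement of an s-AFA by De Morganization: dualize the initial formula and all
target formulas, and complement the set of accepting states. -/
noncomputable def SAFA.compl {α : Type*} (M : SAFA α) : SAFA α where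
  Q := M.Q
  init := M.init.dual
  F := M.Fᶜ
  Δ :=
    letI := Classical.decEq (M.Q × Set α × PBF M.Q)
    M.Δ.image (fun t => (t.1, t.2.1, t.2.2.dual))

theorem PBF.eval_subst {Q R : Type*} (m : R → Bool) (σ : Q → PBF R) (p : PBF Q) :
    (p.subst σ).eval m = p.eval (fun q => (σ q).eval m) := by
  induction p <;> simp_all [PBF.subst, PBF.eval]

theorem PBF.eval_dual {Q : Type*} (m : Q → Bool) (p : PBF Q) :
    p.dual.eval m = !p.eval (fun q => !m q) := by
  induction p <;> simp_all [PBF.dual, PBF.eval]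

theorem PBF.eval_foldr_or {ι Q : Type*} (m : Q → Bool) (f : ι → PBF Q) (l : List ι) :
    (l.foldr (fun t acc => PBF.or (f t) acc) .ff).eval m = true ↔
      ∃ t ∈ l, (f t).eval m = true := by
  induction l <;> simp_all [PBF.eval]

theorem SAFA.eval_step {α : Type*} (M : SAFA α) (a : α) (s : M.Q) (m : M.Q → Bool) :
    (M.step a s).eval m = true ↔
      ∃ φ p, (s, φ, p) ∈ M.Δ ∧ a ∈ φ ∧ p.eval m = true := by
  unfold SAFA.step
  rw [PBF.eval_foldr_or]
  simp only [List.mem_filter, Finset.mem_toList, decide_eq_true_eq]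
  constructor
  · rintro ⟨⟨_, φ, p⟩, ⟨h, rfl, ha⟩, hp⟩
    exact ⟨φ, p, h, ha, hp⟩
  · rintro ⟨φ, p, h, ha, hp⟩
    exact ⟨(s, φ, p), ⟨h, rfl, ha⟩, hp⟩

theorem SAFA.mem_compl_Δ {α : Type*} (M : SAFA α) (s : M.Q) (φ : Set α) (p : PBF M.Q) :
    (s, φ, p) ∈ M.compl.Δ ↔ ∃ q, (s, φ, q) ∈ M.Δ ∧ q.dual = p := by
  let := Classical.decEq (M.Q × Set α × PBF M.Q)
  refine Finset.mem_image.trans ⟨?_, ?_⟩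
  · rintro ⟨⟨_, _, q⟩, h, heq⟩
    cases heq
    exact ⟨q, h, rfl⟩
  · rintro ⟨q, h, rfl⟩
    exact ⟨(s, φ, q), h, rfl⟩

theorem SAFA.eval_compl_step {α : Type*} (M : SAFA α) (hM : M.Normal) (a : α) (s : M.Q)
    (m : M.Q → Bool) :
    PBF.eval (Q := M.Q) m (M.compl.step a s) = !(M.step a s).eval (fun q => !m q) := by
  obtain ⟨⟨φ, p⟩, ⟨h, ha⟩, huniq⟩ := hM s a
  have hstep : (M.step a s).eval (fun q => !m q) = p.eval (fun q => !m q) := by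
    rw [Bool.eq_iff_iff, SAFA.eval_step]
    constructor
    · rintro ⟨φ', p', h', ha', hp'⟩
      obtain ⟨rfl, rfl⟩ := Prod.mk.inj (huniq (φ', p') ⟨h', ha'⟩)
      exact hp'
    · exact fun hp => ⟨φ, p, h, ha, hp⟩
  rw [hstep, ← PBF.eval_dual, Bool.eq_iff_iff]
  refine (M.compl.eval_step a s m).trans ⟨?_, ?_⟩
  · rintro ⟨φ', p', h', ha', hp'⟩
    obtain ⟨q, hq, rfl⟩ := (M.mem_compl_Δ s φ' p').1 h'
    obtain ⟨rfl, rfl⟩ := Prod.mk.inj (huniq (φ', q) ⟨hq, ha'⟩)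
    exact hp'
  · exact fun hp => ⟨φ, p.dual, (M.mem_compl_Δ s φ p.dual).2 ⟨p, h, rfl⟩, ha, hp⟩

theorem SAFA.eval_compl_run {α : Type*} (M : SAFA α) (hM : M.Normal) (w : List α)
    (p p' : PBF M.Q) (hp : ∀ m, p'.eval m = !p.eval (fun q => !m q)) (m : M.Q → Bool) :
    PBF.eval (Q := M.Q) m (M.compl.run w p') = !(M.run w p).eval (fun q => !m q) := by
  induction w generalizing p p' with
  | nil => exact hp m
  | cons a w ih =>
    refine ih (p.subst (M.step a)) (PBF.subst (Q := M.Q) (R := M.Q) (M.compl.step a) p')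
      fun m => ?_
    refine (PBF.eval_subst (Q := M.Q) (R := M.Q) m (M.compl.step a) p').trans ?_
    simp only [PBF.eval_subst, hp, M.eval_compl_step hM, Bool.not_not]

/-- For a normal s-AFA, the complement construction recognizes the complement
language. -/
theorem stmt_11 {α : Type*} (M : SAFA α) (hM : M.Normal) :
    M.compl.lang = (Set.univ : Set (List α)) \ M.lang := by
  classical
  ext w
  have h : M.compl.Fhat (M.compl.run w M.compl.init) = !M.Fhat (M.run w M.init) := by
    refine (M.eval_compl_run hM w M.init M.init.dual (fun m => PBF.eval_dual m _) _).trans ?_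
    unfold SAFA.Fhat
    congr 2
    funext q
    by_cases hq : q ∈ M.F
    · rw [decide_eq_true hq]
      exact congrArg not (decide_eq_false (p := q ∈ M.compl.F) fun h => h hq)
    · rw [decide_eq_false hq]
      exact congrArg not (decide_eq_true (p := q ∈ M.compl.F) hq)
  simp [SAFA.lang, SAFA.langOf, h]
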